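/- Let g be a non-negative monotone submodular set function on a finite set U with g(∅) = 0, d a metric distance on U, D the sum-sum diversity of d, f = g + D, k ≥ 10 and m ≥ 1. Let (T¹,…,Tᵐ) be a uniformly random m-partition of U, let Sⁱ = ALG(Tⁱ) be the output of the greedy algorithm on part i, and let ALG' be any algorithm that, given any finite V ⊆ U, outputs a k-subset S' of V with f(S') ≥ (1/2)·max{f(R) : R ⊆ V, |R| = k} (a 1/2-approximation, as the AltGreedy algorithm of Borodin et al. is). Let O be a k-subset of U maximizing f over all k-subsets of U, and let S = ALG'(∪_{i=1}^m Sⁱ). Then E[f(S)] ≥ (1/31)·f(O), where the expectation is over the random partition. -/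

import Mathlib

open Finset

/-- Sum-sum diversity: the sum of `d u v` over all unordered pairs of distinct
elements of `S` (each unordered pair counted once). -/
noncomputable def sumsumDiv {α : Type*} [DecidableEq α] (d : α → α → ℝ) (S : Finset α) : ℝ :=
  (∑ p ∈ S.offDiag, d p.1 p.2) / 2

/-- The marginal gain used by the greedy algorithm:
`gain g d S u = Δ(u, S) + ∑_{x ∈ S} d x u`. -/
noncomputable def gain {α : Type*} [DecidableEq α] (g : Finset α → ℝ) (d : α → α → ℝ)
    (S : Finset α) (u : α) : ℝ :=
  (g (insert u S) - g S) + ∑ x ∈ S, d x u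

open scoped Classical in
/-- Pick, among the elements of `C`, the one maximizing `h` with ties broken by a fixed
a-priori linear ordering (the earliest maximizer); returns it as a singleton set,
or `∅` if `C = ∅`. -/
noncomputable def pick {α : Type*} [LinearOrder α] (h : α → ℝ) (C : Finset α) : Finset α :=
  if hne : (C.filter fun u => ∀ v ∈ C, h v ≤ h u).Nonempty then
    {(C.filter fun u => ∀ v ∈ C, h v ≤ h u).min' hne}
  else ∅

open scoped Classical in
/-- `greedy g d n T` is the set selected after `n` steps of Algorithm 1 (Greedy) on the
ground set `T`: at each step it adds the element of `T` maximizing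
`Δ(u, S) + ∑_{x ∈ S} d x u`, with ties broken consistently by a fixed a-priori ordering. -/
noncomputable def greedy {α : Type*} [LinearOrder α] (g : Finset α → ℝ) (d : α → α → ℝ) :
    ℕ → Finset α → Finset α
  | 0, _ => ∅
  | n + 1, T =>
      let S := greedy g d n T
      S ∪ pick (gain g d S) (T \ S)

/-- Part `i` of the partition of the finite ground set induced by the assignment `π`. -/
def part {α : Type*} [Fintype α] {m : ℕ} (π : α → Fin m) (i : Fin m) : Finset α :=
  Finset.univ.filter fun a => π a = i

/-- Expectation of `F` over a uniformly random `m`-partition of the finite ground set,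
i.e. over a uniformly random assignment `π` of each element independently and uniformly
to one of the `m` parts. -/
noncomputable def expVal {α : Type*} [Fintype α] [DecidableEq α] (m : ℕ)
    (F : (α → Fin m) → ℝ) : ℝ :=
  (∑ π : α → Fin m, F π) / (m : ℝ) ^ (Fintype.card α)

section Diversity

variable {α : Type*} [DecidableEq α] {d : α → α → ℝ}

lemma sumsumDiv_eq_sum_sum (hd0 : ∀ u, d u u = 0) (S : Finset α) :
    sumsumDiv d S = (∑ u ∈ S, ∑ v ∈ S, d u v) / 2 := by
  have h := Finset.sum_union (f := fun p : α × α => d p.1 p.2) (Finset.disjoint_diag_offDiag S)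
  have hz : ∑ p ∈ S.diag, d p.1 p.2 = 0 :=
    Finset.sum_eq_zero fun p hp => by rw [(Finset.mem_diag.1 hp).2, hd0]
  rw [Finset.diag_union_offDiag, hz, Finset.sum_product] at h
  rw [sumsumDiv]
  linarith

lemma sumsumDiv_nonneg (hdnn : ∀ u v, 0 ≤ d u v) (S : Finset α) : 0 ≤ sumsumDiv d S :=
  div_nonneg (Finset.sum_nonneg fun _ _ => hdnn _ _) two_pos.le

lemma sumsumDiv_mono (hdnn : ∀ u v, 0 ≤ d u v) {A B : Finset α} (h : A ⊆ B) :
    sumsumDiv d A ≤ sumsumDiv d B := by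
  have := Finset.sum_le_sum_of_subset_of_nonneg (f := fun p : α × α => d p.1 p.2)
    (Finset.offDiag_mono h) fun _ _ _ => hdnn _ _
  simp only [sumsumDiv]
  linarith

lemma sumsumDiv_union (hd0 : ∀ u, d u u = 0) (hdsymm : ∀ u v, d u v = d v u) {A B : Finset α}
    (h : Disjoint A B) :
    sumsumDiv d (A ∪ B) = sumsumDiv d A + sumsumDiv d B + ∑ a ∈ A, ∑ b ∈ B, d a b := by
  have hc : ∑ b ∈ B, ∑ a ∈ A, d b a = ∑ a ∈ A, ∑ b ∈ B, d a b := by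
    rw [Finset.sum_comm]
    exact Finset.sum_congr rfl fun _ _ => Finset.sum_congr rfl fun _ _ => hdsymm _ _
  simp only [sumsumDiv_eq_sum_sum hd0, Finset.sum_union h, Finset.sum_add_distrib]
  linarith

lemma sumsumDiv_insert (hd0 : ∀ u, d u u = 0) (hdsymm : ∀ u v, d u v = d v u) {S : Finset α}
    {u : α} (hu : u ∉ S) :
    sumsumDiv d (insert u S) = sumsumDiv d S + ∑ x ∈ S, d x u := by
  have h := sumsumDiv_union hd0 hdsymm (Finset.disjoint_singleton_right.2 hu)
  have h1 : sumsumDiv d {u} = 0 := by simp [sumsumDiv_eq_sum_sum hd0, hd0]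
  rw [Finset.insert_eq, Finset.union_comm, h, h1]
  simp

/-- The distances between disjoint sets `H` and `B` of sizes at most `h` and `2 * l` are controlled
by the diversity of sets of size at most `h + l`. -/
lemma sum_sum_dist_le (hd0 : ∀ u, d u u = 0) (hdnn : ∀ u v, 0 ≤ d u v)
    (hdsymm : ∀ u v, d u v = d v u) {h l : ℕ} {Q : ℝ} {V : Finset α}
    (hQ : ∀ R ⊆ V, R.card ≤ h + l → sumsumDiv d R ≤ Q)
    {H B : Finset α} (hH : H ⊆ V) (hB : B ⊆ V) (hHB : Disjoint H B) (hHc : H.card ≤ h)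
    (hBc : B.card ≤ 2 * l) :
    ∑ v ∈ B, ∑ x ∈ H, d x v ≤ 2 * Q := by
  have hsmall : ∀ C ⊆ B, C.card ≤ l → ∑ v ∈ C, ∑ x ∈ H, d x v ≤ Q := by
    intro C hC hCc
    have h1 := hQ (H ∪ C) (Finset.union_subset hH (hC.trans hB))
      ((Finset.card_union_le _ _).trans (add_le_add hHc hCc))
    rw [sumsumDiv_union hd0 hdsymm (Finset.disjoint_of_subset_right hC hHB),
      Finset.sum_comm] at h1
    linarith [sumsumDiv_nonneg hdnn H, sumsumDiv_nonneg hdnn C]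
  obtain ⟨C, hCB, hC⟩ := Finset.exists_subset_card_eq (Nat.min_le_left B.card l)
  have hsplit := Finset.sum_sdiff (f := fun v => ∑ x ∈ H, d x v) hCB
  have h1 := hsmall C hCB (by omega)
  have h2 := hsmall (B \ C) Finset.sdiff_subset (by
    rw [Finset.card_sdiff_of_subset hCB]; omega)
  linarith

/-- If the points of `O` outside `V` are, on average, close to subsets `H u` of `V` of size `h`,
then replacing `O` by `O ∩ V` loses only a multiple of the best diversity inside `V`. -/
lemma sumsumDiv_le_inter_add (hd0 : ∀ u, d u u = 0) (hdnn : ∀ u v, 0 ≤ d u v)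
    (hdsymm : ∀ u v, d u v = d v u) (hdtri : ∀ u v w, d u w ≤ d u v + d v w)
    {h l : ℕ} (hh : 5 ≤ h) (hl : h ≤ l) (hl' : l ≤ h + 1) {Q : ℝ} {V O : Finset α}
    (hQ : ∀ R ⊆ V, R.card ≤ h + l → sumsumDiv d R ≤ Q) (hO : O.card = h + l)
    (H : α → Finset α) (hHV : ∀ u ∈ O \ V, H u ⊆ V) (hHc : ∀ u ∈ O \ V, (H u).card = h)
    (hHd : ∀ u ∈ O \ V, ∀ v ∈ O \ V, H u = H v ∨ Disjoint (H u) (H v))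
    (hHQ : ∀ u ∈ O \ V, l * ∑ x ∈ H u, d x u ≤ Q) :
    sumsumDiv d O ≤ sumsumDiv d (O ∩ V) + 25 / 2 * Q := by
  have hQ0 : 0 ≤ Q := by simpa [sumsumDiv] using hQ ∅ (by simp) (by simp)
  have hhR : (5 : ℝ) ≤ h := by exact_mod_cast hh
  have hlR : (h : ℝ) ≤ l := by exact_mod_cast hl
  have hl0 : (0 : ℝ) < l := by linarith
  have hh0 : (0 : ℝ) < h := by linarith
  set q : ℝ := Q / l with hq
  have hq0 : 0 ≤ q := by positivity
  have hHq : ∀ u ∈ O \ V, ∑ x ∈ H u, d x u ≤ q := fun u hu => by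
    rw [hq, le_div_iff₀ hl0, mul_comm]; exact hHQ u hu
  have hpair : ∀ u ∈ O \ V, ∀ v ∈ O \ V, d u v ≤ 2 * q / h + Q / h ^ 2 := by
    intro u hu v hv
    have hu' := hHq u hu
    have hv' := hHq v hv
    rcases hHd u hu v hv with he | he
    · have h1 : ∑ _x ∈ H u, d u v ≤ ∑ x ∈ H u, (d x u + d x v) :=
        Finset.sum_le_sum fun x _ => by
          have := hdtri u x v
          rwa [hdsymm u x] at this
      rw [Finset.sum_add_distrib, Finset.sum_const, hHc u hu, nsmul_eq_mul] at h1
      rw [← he] at hv'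
      have h2 : d u v ≤ 2 * q / h := by
        rw [le_div_iff₀ hh0]; linarith
      have : 0 ≤ Q / (h : ℝ) ^ 2 := by positivity
      linarith
    · have h1 : ∑ _x ∈ H u, ∑ _y ∈ H v, d u v ≤
          ∑ x ∈ H u, ∑ y ∈ H v, (d x u + d x y + d y v) :=
        Finset.sum_le_sum fun x _ => Finset.sum_le_sum fun y _ => by
          have h2 := hdtri u x v
          have h3 := hdtri x y v
          rw [hdsymm u x] at h2
          linarith
      simp only [Finset.sum_add_distrib, Finset.sum_const, hHc u hu, hHc v hv, nsmul_eq_mul,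
        ← Finset.mul_sum] at h1
      have h4 := hQ (H u ∪ H v) (Finset.union_subset (hHV u hu) (hHV v hv))
        ((Finset.card_union_le _ _).trans (by rw [hHc u hu, hHc v hv]; omega))
      rw [sumsumDiv_union hd0 hdsymm he] at h4
      have h5 := sumsumDiv_nonneg hdnn (H u)
      have h6 := sumsumDiv_nonneg hdnn (H v)
      have h7 : d u v * h ^ 2 ≤ 2 * q * h + Q := by nlinarith
      have h8 : 2 * q / h + Q / h ^ 2 = (2 * q * h + Q) / (h : ℝ) ^ 2 := by field_simp
      rw [h8, le_div_iff₀ (by positivity)]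
      exact h7
  set A := O ∩ V with hA
  set M := O \ V with hM
  have hcard : (M.card : ℝ) + A.card = h + l := by
    have : M.card + A.card = O.card := Finset.card_sdiff_add_card_inter O V
    rw [hO] at this
    exact_mod_cast this
  have hAV : A ⊆ V := Finset.inter_subset_right
  have hcross : ∀ u ∈ M, ∑ v ∈ A, d u v ≤ q + (A.card * q + 2 * Q) / h := by
    intro u hu
    rw [← Finset.sum_inter_add_sum_sdiff A (H u)]
    refine add_le_add ?_ ?_
    · refine le_trans ?_ (hHq u hu)
      simp only [hdsymm u]
      exact Finset.sum_le_sum_of_subset_of_nonneg Finset.inter_subset_right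
        fun _ _ _ => hdnn _ _
    · have h1 : ∑ v ∈ A \ H u, ∑ _x ∈ H u, d u v ≤ ∑ v ∈ A \ H u, ∑ x ∈ H u, (d x u + d x v) :=
        Finset.sum_le_sum fun v _ => Finset.sum_le_sum fun x _ => by
          have := hdtri u x v
          rwa [hdsymm u x] at this
      have h2 := sum_sum_dist_le hd0 hdnn hdsymm hQ (hHV u hu)
        (Finset.sdiff_subset.trans hAV : A \ H u ⊆ V) Finset.disjoint_sdiff (hHc u hu).le (by
          have := Finset.card_le_card (Finset.sdiff_subset (s := A) (t := H u))
          have : A.card ≤ O.card := Finset.card_le_card Finset.inter_subset_left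
          omega)
      have h3 : ((A \ H u).card : ℝ) * ∑ x ∈ H u, d x u ≤ A.card * q :=
        mul_le_mul (by exact_mod_cast Finset.card_le_card Finset.sdiff_subset) (hHq u hu)
          (Finset.sum_nonneg fun _ _ => hdnn _ _) (Nat.cast_nonneg _)
      simp only [Finset.sum_add_distrib, Finset.sum_const, hHc u hu, nsmul_eq_mul,
        ← Finset.mul_sum] at h1
      rw [le_div_iff₀ hh0]
      linarith
  have hsplit := sumsumDiv_union hd0 hdsymm (Finset.disjoint_sdiff_inter O V)
  rw [Finset.sdiff_union_inter] at hsplit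
  have hDM : sumsumDiv d M ≤ (M.card * (M.card - 1)) * (2 * q / h + Q / h ^ 2) / 2 := by
    have h1 : ∑ p ∈ M.offDiag, d p.1 p.2 ≤ M.offDiag.card • (2 * q / h + Q / h ^ 2) :=
      Finset.sum_le_card_nsmul _ _ _ fun p hp =>
        hpair _ (Finset.mem_offDiag.1 hp).1 _ (Finset.mem_offDiag.1 hp).2.1
    rw [nsmul_eq_mul, Finset.offDiag_card, Nat.cast_sub (Nat.le_mul_self _)] at h1
    push_cast at h1
    rw [sumsumDiv]
    linarith
  have hDAM := Finset.sum_le_card_nsmul M _ _ hcross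
  rw [nsmul_eq_mul] at hDAM
  have hm0 : (0 : ℝ) ≤ M.card := Nat.cast_nonneg _
  have hmk : (M.card : ℝ) ≤ h + l := by
    linarith [(Nat.cast_nonneg A.card : (0 : ℝ) ≤ A.card)]
  have hmm : (M.card : ℝ) * (M.card - 1) ≤ (h + l) * (h + l - 1) := by nlinarith
  have hA' : (A.card : ℝ) = h + l - M.card := by linarith
  rw [hA'] at hDAM
  have hbound : (M.card * (M.card - 1)) * (2 * q / h + Q / h ^ 2) / 2 +
      M.card * (q + ((h + l - M.card) * q + 2 * Q) / h) ≤
      (h + l) * ((h + l - 1) * q / h + q + 2 * Q / h) +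
        (h + l) * (h + l - 1) * (Q / h ^ 2) / 2 := by
    have h1 : (M.card * (M.card - 1)) * (2 * q / h + Q / h ^ 2) / 2 +
        M.card * (q + ((h + l - M.card) * q + 2 * Q) / h) =
        M.card * ((h + l - 1) * q / h + q + 2 * Q / h) +
          (M.card * (M.card - 1)) * (Q / h ^ 2) / 2 := by
      field_simp
      ring
    rw [h1]
    have h2 : (0 : ℝ) ≤ h + l - 1 := by linarith
    gcongr
  have hfin : (h + l : ℝ) * ((h + l - 1) * q / h + q + 2 * Q / h) +
        (h + l) * (h + l - 1) * (Q / h ^ 2) / 2 ≤ 25 / 2 * Q := by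
    rcases (by omega : l = h ∨ l = h + 1) with rfl | rfl
    · rw [hq]
      have : (l + l : ℝ) * ((l + l - 1) * (Q / l) / l + Q / l + 2 * Q / l) +
        (l + l) * (l + l - 1) * (Q / l ^ 2) / 2 = 12 * Q - 3 * (Q / l) := by
        field_simp
        ring
      rw [this]
      linarith
    · rw [hq]
      push_cast at hl0 ⊢
      have : (h + (h + 1) : ℝ) * ((h + (h + 1) - 1) * (Q / (h + 1)) / h + Q / (h + 1) + 2 * Q / h) +
          (h + (h + 1)) * (h + (h + 1) - 1) * (Q / h ^ 2) / 2 =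
          12 * Q + 3 / (h * (h + 1)) * Q := by
        field_simp
        ring
      rw [this]
      have : 3 / (h * (h + 1) : ℝ) ≤ 1 / 2 := by
        rw [div_le_div_iff₀ (by positivity) two_pos]
        nlinarith
      nlinarith
  linarith

end Diversity

section Submodular

variable {α : Type*} [DecidableEq α] {g : Finset α → ℝ}

lemma submodular_union_sub_le
    (hgsub : ∀ A B : Finset α, A ⊆ B → ∀ y ∉ B, g (insert y B) - g B ≤ g (insert y A) - g A)
    (hgmono : ∀ A B : Finset α, A ⊆ B → g A ≤ g B) (S B : Finset α) :
    g (S ∪ B) - g S ≤ ∑ y ∈ B, (g (insert y S) - g S) := by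
  induction B using Finset.induction_on with
  | empty => simp
  | insert y B hy ih =>
    rw [Finset.sum_insert hy, Finset.union_insert]
    by_cases hyS : y ∈ S ∪ B
    · rw [Finset.insert_eq_of_mem hyS]
      linarith [hgmono S (insert y S) (Finset.subset_insert _ _)]
    · linarith [hgsub S (S ∪ B) Finset.subset_union_left y hyS]

/-- The base polytope of a normalized submodular function is nonempty. -/
lemma submodular_exists_weight
    (hgsub : ∀ A B : Finset α, A ⊆ B → ∀ y ∉ B, g (insert y B) - g B ≤ g (insert y A) - g A)
    (hg0 : g ∅ = 0) (O : Finset α) :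
    ∃ w : α → ℝ, ∑ o ∈ O, w o = g O ∧ ∀ X ⊆ O, ∑ o ∈ X, w o ≤ g X := by
  induction O using Finset.induction_on with
  | empty => exact ⟨0, by simp [hg0], fun X hX => by simp [Finset.subset_empty.1 hX, hg0]⟩
  | insert y O hy ih =>
    obtain ⟨w, hw, hX⟩ := ih
    have hupd : ∀ X : Finset α, y ∉ X →
        ∑ o ∈ X, Function.update w y (g (insert y O) - g O) o = ∑ o ∈ X, w o := fun X hyX =>
      Finset.sum_congr rfl fun o ho => Function.update_of_ne (ne_of_mem_of_not_mem ho hyX) _ _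
    refine ⟨Function.update w y (g (insert y O) - g O), ?_, fun X hXO => ?_⟩
    · rw [Finset.sum_insert hy, hupd O hy, Function.update_self, hw]
      ring
    · by_cases hyX : y ∈ X
      · have hsub : X.erase y ⊆ O := fun x hx =>
          (Finset.mem_insert.1 (hXO (Finset.mem_of_mem_erase hx))).resolve_left
            (Finset.ne_of_mem_erase hx)
        have h1 := hgsub _ _ hsub y hy
        have h2 := hX _ hsub
        rw [Finset.insert_erase hyX] at h1
        rw [← Finset.add_sum_erase _ _ hyX, hupd _ (Finset.notMem_erase _ _),
          Function.update_self]
        linarith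
      · rw [hupd X hyX]
        exact hX X fun x hx =>
          (Finset.mem_insert.1 (hXO hx)).resolve_left fun h => hyX (by rwa [h] at hx)

end Submodular

section Greedy

variable {α : Type*} [LinearOrder α] {g : Finset α → ℝ} {d : α → α → ℝ}

lemma exists_pick_eq_singleton (h : α → ℝ) {C : Finset α} (hC : C.Nonempty) :
    ∃ u ∈ C, (∀ v ∈ C, h v ≤ h u) ∧ pick h C = {u} := by
  classical
  obtain ⟨w, hw, hmax⟩ := C.exists_max_image h hC
  have hne : (C.filter fun u => ∀ v ∈ C, h v ≤ h u).Nonempty :=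
    ⟨w, Finset.mem_filter.2 ⟨hw, hmax⟩⟩
  have hmem := Finset.mem_filter.1 (Finset.min'_mem _ hne)
  refine ⟨_, hmem.1, hmem.2, ?_⟩
  rw [pick, dif_pos]

lemma pick_subset (h : α → ℝ) (C : Finset α) : pick h C ⊆ C := by
  rcases C.eq_empty_or_nonempty with rfl | hC
  · simp [pick]
  · obtain ⟨u, hu, -, he⟩ := exists_pick_eq_singleton h hC
    rw [he]
    exact Finset.singleton_subset_iff.2 hu

lemma pick_insert_of_notMem (h : α → ℝ) {C : Finset α} {o : α}
    (ho : o ∉ pick h (insert o C)) : pick h (insert o C) = pick h C := by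
  classical
  by_cases hoC : o ∈ C
  · rw [Finset.insert_eq_of_mem hoC]
  have hne : ((insert o C).filter fun u => ∀ v ∈ insert o C, h v ≤ h u).Nonempty := by
    obtain ⟨w, hw, hmax⟩ := (insert o C).exists_max_image h (Finset.insert_nonempty _ _)
    exact ⟨w, Finset.mem_filter.2 ⟨hw, hmax⟩⟩
  have hmem := Finset.min'_mem _ hne
  have hle : ∀ x ∈ (insert o C).filter (fun u => ∀ v ∈ insert o C, h v ≤ h u),
      Finset.min' _ hne ≤ x := fun x hx => Finset.min'_le _ x hx
  have hp : pick h (insert o C) = {Finset.min' _ hne} := by rw [pick, dif_pos]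
  rw [hp] at ho ⊢
  generalize Finset.min' _ hne = u at ho hmem hle
  rw [Finset.mem_filter] at hmem
  have huo : u ≠ o := fun he => ho (by simp [he])
  have huC : u ∈ C := (Finset.mem_insert.1 hmem.1).resolve_left huo
  have hne' : (C.filter fun u => ∀ v ∈ C, h v ≤ h u).Nonempty :=
    ⟨u, Finset.mem_filter.2 ⟨huC, fun v hv => hmem.2 v (Finset.mem_insert_of_mem hv)⟩⟩
  have hp' : pick h C = {Finset.min' _ hne'} := by rw [pick, dif_pos]
  rw [hp', Finset.singleton_inj]
  refine le_antisymm (hle _ ?_) (Finset.min'_le _ _ ?_)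
  · have hm := Finset.mem_filter.1 (Finset.min'_mem _ hne')
    refine Finset.mem_filter.2 ⟨Finset.mem_insert_of_mem hm.1, fun v hv => ?_⟩
    exact (hmem.2 v hv).trans (hm.2 u huC)
  · exact Finset.mem_filter.2 ⟨huC, fun v hv => hmem.2 v (Finset.mem_insert_of_mem hv)⟩

lemma greedy_subset (n : ℕ) (T : Finset α) : greedy g d n T ⊆ T := by
  induction n with
  | zero => simp [greedy]
  | succ n ih => exact Finset.union_subset ih ((pick_subset _ _).trans Finset.sdiff_subset)

lemma greedy_mono (T : Finset α) : Monotone fun n => greedy g d n T :=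
  monotone_nat_of_le_succ fun _ => Finset.subset_union_left

lemma greedy_insert_of_notMem {n : ℕ} {T : Finset α} {o : α}
    (ho : o ∉ greedy g d n (insert o T)) : greedy g d n (insert o T) = greedy g d n T := by
  induction n with
  | zero => rfl
  | succ n ih =>
    have ho' : o ∉ greedy g d n (insert o T) := fun h => ho (greedy_mono _ n.le_succ h)
    have hS := ih ho'
    simp only [greedy, hS] at ho ⊢
    rw [hS] at ho'
    rw [Finset.insert_sdiff_of_notMem _ ho'] at ho ⊢
    rw [pick_insert_of_notMem _ fun h => ho (Finset.mem_union_right _ h)]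

lemma exists_greedy_succ_eq_insert {n : ℕ} {T : Finset α} {o : α} (hoT : o ∈ T)
    (ho : o ∉ greedy g d n T) :
    ∃ u ∉ greedy g d n T, greedy g d (n + 1) T = insert u (greedy g d n T) ∧
      gain g d (greedy g d n T) o ≤ gain g d (greedy g d n T) u := by
  have hmem : o ∈ T \ greedy g d n T := Finset.mem_sdiff.2 ⟨hoT, ho⟩
  obtain ⟨u, hu, hmax, he⟩ := exists_pick_eq_singleton (gain g d (greedy g d n T)) ⟨o, hmem⟩
  refine ⟨u, (Finset.mem_sdiff.1 hu).2, ?_, hmax o hmem⟩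
  rw [greedy]
  simp only [he]
  rw [Finset.union_comm, ← Finset.insert_eq]

lemma card_greedy_le (n : ℕ) (T : Finset α) : (greedy g d n T).card ≤ n := by
  induction n with
  | zero => simp [greedy]
  | succ n ih =>
    rcases (T \ greedy g d n T).eq_empty_or_nonempty with h | ⟨o, ho⟩
    · have : greedy g d (n + 1) T = greedy g d n T := by simp [greedy, h, pick]
      rw [this]
      omega
    · obtain ⟨u, -, he, -⟩ := exists_greedy_succ_eq_insert (g := g) (d := d)
        (Finset.mem_sdiff.1 ho).1 (Finset.mem_sdiff.1 ho).2
      rw [he]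
      exact (Finset.card_insert_le _ _).trans (by omega)

lemma card_greedy {n : ℕ} {T : Finset α} {o : α} (hoT : o ∈ T) (ho : o ∉ greedy g d n T) :
    (greedy g d n T).card = n := by
  induction n with
  | zero => simp [greedy]
  | succ n ih =>
    have ho' : o ∉ greedy g d n T := fun h => ho (greedy_mono _ n.le_succ h)
    obtain ⟨u, hu, he, -⟩ := exists_greedy_succ_eq_insert hoT ho'
    rw [he, Finset.card_insert_of_notMem hu, ih ho']

/-- Each greedy step increases the objective by at least the gain of any rejected element. -/
lemma add_gain_le_greedy_succ (hd0 : ∀ u, d u u = 0) (hdsymm : ∀ u v, d u v = d v u) {n : ℕ}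
    {T : Finset α} {o : α} (hoT : o ∈ T) (ho : o ∉ greedy g d n T) :
    g (greedy g d n T) + sumsumDiv d (greedy g d n T) + gain g d (greedy g d n T) o ≤
      g (greedy g d (n + 1) T) + sumsumDiv d (greedy g d (n + 1) T) := by
  obtain ⟨u, hu, he, hle⟩ := exists_greedy_succ_eq_insert hoT ho
  rw [he, sumsumDiv_insert hd0 hdsymm hu]
  refine (add_le_add_right hle _).trans (le_of_eq ?_)
  simp only [gain]
  ring

lemma mul_marginal_le_greedy (hg0 : g ∅ = 0)
    (hgsub : ∀ A B : Finset α, A ⊆ B → ∀ y ∉ B, g (insert y B) - g B ≤ g (insert y A) - g A)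
    (hd0 : ∀ u, d u u = 0) (hdnn : ∀ u v, 0 ≤ d u v) (hdsymm : ∀ u v, d u v = d v u) {n : ℕ}
    {T : Finset α} {o : α} (hoT : o ∈ T) (ho : o ∉ greedy g d n T) :
    n * (g (insert o (greedy g d n T)) - g (greedy g d n T)) ≤
      g (greedy g d n T) + sumsumDiv d (greedy g d n T) := by
  induction n with
  | zero => simp [greedy, hg0, sumsumDiv]
  | succ n ih =>
    have ho' : o ∉ greedy g d n T := fun h => ho (greedy_mono _ n.le_succ h)
    have h1 := ih ho'
    have h2 := add_gain_le_greedy_succ (g := g) hd0 hdsymm hoT ho'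
    have h3 := hgsub _ _ (greedy_mono (g := g) (d := d) T n.le_succ) o ho
    have h4 : 0 ≤ ∑ x ∈ greedy g d n T, d x o := Finset.sum_nonneg fun _ _ => hdnn _ _
    simp only [gain] at h2
    push_cast
    dsimp only at h3
    have h5 := mul_le_mul_of_nonneg_left h3 (by positivity : (0 : ℝ) ≤ n + 1)
    linarith

lemma mul_sum_dist_le_greedy (hgnn : ∀ S : Finset α, 0 ≤ g S)
    (hgmono : ∀ A B : Finset α, A ⊆ B → g A ≤ g B)
    (hd0 : ∀ u, d u u = 0) (hdnn : ∀ u v, 0 ≤ d u v) (hdsymm : ∀ u v, d u v = d v u) {h l : ℕ}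
    {T : Finset α} {o : α} (hoT : o ∈ T) (ho : o ∉ greedy g d (h + l) T) :
    l * ∑ x ∈ greedy g d h T, d x o ≤
      g (greedy g d (h + l) T) + sumsumDiv d (greedy g d (h + l) T) := by
  induction l with
  | zero =>
    simpa using add_nonneg (hgnn (greedy g d h T)) (sumsumDiv_nonneg hdnn (greedy g d h T))
  | succ l ih =>
    rw [← add_assoc] at ho ⊢
    have ho' : o ∉ greedy g d (h + l) T := fun hm => ho (greedy_mono _ (h + l).le_succ hm)
    have h1 := ih ho'
    have h2 := add_gain_le_greedy_succ (g := g) hd0 hdsymm hoT ho'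
    have h3 : ∑ x ∈ greedy g d h T, d x o ≤ ∑ x ∈ greedy g d (h + l) T, d x o :=
      Finset.sum_le_sum_of_subset_of_nonneg (greedy_mono T (Nat.le_add_right h l))
        fun _ _ _ => hdnn _ _
    have h4 := hgmono _ _ (Finset.subset_insert o (greedy g d (h + l) T))
    simp only [gain] at h2
    push_cast
    linarith

/-- Elements that greedy would reject even when offered have small joint value. -/
lemma le_of_forall_notMem_greedy (hgnn : ∀ S : Finset α, 0 ≤ g S)
    (hgmono : ∀ A B : Finset α, A ⊆ B → g A ≤ g B) (hg0 : g ∅ = 0)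
    (hgsub : ∀ A B : Finset α, A ⊆ B → ∀ y ∉ B, g (insert y B) - g B ≤ g (insert y A) - g A)
    (hd0 : ∀ u, d u u = 0) (hdnn : ∀ u v, 0 ≤ d u v) (hdsymm : ∀ u v, d u v = d v u) {k : ℕ}
    (hk : 0 < k) {T B : Finset α} (hB : ∀ o ∈ B, o ∉ greedy g d k (insert o T))
    (hBc : B.card ≤ k) :
    g B ≤ g (greedy g d k T) + (g (greedy g d k T) + sumsumDiv d (greedy g d k T)) := by
  set S := greedy g d k T with hS
  have hk' : (0 : ℝ) < k := by exact_mod_cast hk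
  have hf : 0 ≤ g S + sumsumDiv d S := add_nonneg (hgnn S) (sumsumDiv_nonneg hdnn S)
  have h1 := submodular_union_sub_le hgsub hgmono S B
  have h2 := hgmono B (S ∪ B) Finset.subset_union_right
  have h3 : ∑ y ∈ B, (g (insert y S) - g S) ≤ B.card • ((g S + sumsumDiv d S) / k) := by
    refine Finset.sum_le_card_nsmul _ _ _ fun o ho => ?_
    have h4 := mul_marginal_le_greedy hg0 hgsub hd0 hdnn hdsymm
      (Finset.mem_insert_self o T) (hB o ho)
    rw [greedy_insert_of_notMem (hB o ho), ← hS] at h4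
    rw [le_div_iff₀ hk']
    linarith
  have h5 : B.card • ((g S + sumsumDiv d S) / k) ≤ g S + sumsumDiv d S := by
    rw [nsmul_eq_mul, mul_div_assoc', div_le_iff₀ hk', mul_comm]
    exact mul_le_mul_of_nonneg_left (by exact_mod_cast hBc) hf
  linarith

end Greedy

section Partition

variable {α : Type*} {m : ℕ}

/-- Exchange part `c` with the part containing `o`, but keep `o` where it is. -/
def swapPart [DecidableEq α] (o : α) (c : Fin m) (π : α → Fin m) : α → Fin m :=
  fun x => if x = o then π o else Equiv.swap c (π o) (π x)

lemma swapPart_involutive [DecidableEq α] (o : α) (c : Fin m) :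
    Function.Involutive (swapPart o c) := by
  intro π
  funext x
  by_cases hx : x = o <;> simp [swapPart, hx]

variable [Fintype α]

lemma mem_part {π : α → Fin m} {i : Fin m} {a : α} : a ∈ part π i ↔ π a = i := by
  simp [part]

lemma insert_part_swapPart [DecidableEq α] (o : α) (c : Fin m) (π : α → Fin m) :
    insert o (part (swapPart o c π) c) = part π (π o) := by
  ext x
  by_cases hx : x = o
  · simp [hx, mem_part]
  · simp [mem_part, swapPart, hx, Equiv.swap_apply_eq_iff]

variable [LinearOrder α] {g : Finset α → ℝ} {d : α → α → ℝ}

lemma mem_biUnion_greedy_part {k : ℕ} {π : α → Fin m} {o : α} :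
    o ∈ (Finset.univ.biUnion fun i => greedy g d k (part π i)) ↔
      o ∈ greedy g d k (part π (π o)) := by
  simp only [Finset.mem_biUnion, Finset.mem_univ, true_and]
  refine ⟨fun ⟨i, hi⟩ => ?_, fun h => ⟨_, h⟩⟩
  rwa [mem_part.1 (greedy_subset k _ hi)]

open scoped Classical in
/-- An element is selected on its own part as often as it would be selected on part `c`. -/
lemma sum_selected_add_sum_rejected (k : ℕ) (o : α) (c : Fin m) :
    ∑ π : α → Fin m,
      ((if o ∈ Finset.univ.biUnion fun i => greedy g d k (part π i) then (1 : ℝ) else 0) +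
        if o ∉ greedy g d k (insert o (part π c)) then 1 else 0) =
      (m : ℝ) ^ Fintype.card α := by
  rw [Finset.sum_add_distrib, ← Equiv.sum_comp (swapPart_involutive o c).toPerm
    (fun π : α → Fin m => if o ∉ greedy g d k (insert o (part π c)) then (1 : ℝ) else 0),
    ← Finset.sum_add_distrib]
  simp only [Function.Involutive.coe_toPerm, insert_part_swapPart, mem_biUnion_greedy_part]
  rw [Finset.sum_congr rfl (g := fun _ => (1 : ℝ)) fun π _ => by split_ifs <;> simp_all]
  simp

open scoped Classical in
/-- The selected and the rejected elements of `O` together carry the value of `O` on average. -/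
lemma pow_card_mul_le_sum_selected_add_rejected
    (hgsub : ∀ A B : Finset α, A ⊆ B → ∀ y ∉ B, g (insert y B) - g B ≤ g (insert y A) - g A)
    (hg0 : g ∅ = 0) (k : ℕ) (c : Fin m) (O : Finset α) :
    (m : ℝ) ^ Fintype.card α * g O ≤
      ∑ π : α → Fin m, (g (O ∩ Finset.univ.biUnion fun i => greedy g d k (part π i)) +
        g (O.filter fun o => o ∉ greedy g d k (insert o (part π c)))) := by
  obtain ⟨w, hw, hX⟩ := submodular_exists_weight hgsub hg0 O
  rw [← hw, Finset.mul_sum]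
  rw [Finset.sum_congr rfl fun o _ => by
    rw [← sum_selected_add_sum_rejected (g := g) (d := d) k o c, Finset.sum_mul]]
  rw [Finset.sum_comm]
  refine Finset.sum_le_sum fun π _ => ?_
  refine le_trans (le_of_eq ?_) (add_le_add (hX _ Finset.inter_subset_left)
    (hX _ (Finset.filter_subset _ _)))
  rw [← Finset.filter_mem_eq_inter, Finset.sum_filter, Finset.sum_filter,
    ← Finset.sum_add_distrib]
  exact Finset.sum_congr rfl fun o _ => by rw [add_mul, ite_mul, ite_mul, one_mul, zero_mul]

end Partition

/-- Theorem 2, the main result: let `Sⁱ = greedy(Tⁱ)` on the parts of a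
uniformly random `m`-partition of the finite ground set, let `ALG'` be any algorithm
that on every `V` (with at least `k` elements) outputs a `k`-subset of `V` whose
`f`-value is at least half the maximum over `k`-subsets of `V`, and let `O` be a
`k`-subset maximizing `f = g + D` over all `k`-subsets of the ground set. Then
`E[f(ALG'(∪ᵢ Sⁱ))] ≥ (1/31)·f(O)`. -/
theorem stmt17 {α : Type*} [Fintype α] [DecidableEq α] [LinearOrder α]
    (g : Finset α → ℝ)
    (hgnn : ∀ S : Finset α, 0 ≤ g S)
    (hgmono : ∀ A B : Finset α, A ⊆ B → g A ≤ g B)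
    (hgsub : ∀ A B : Finset α, A ⊆ B → ∀ y ∉ B,
      g (insert y B) - g B ≤ g (insert y A) - g A)
    (hg0 : g ∅ = 0)
    (d : α → α → ℝ)
    (hd0 : ∀ u, d u u = 0) (hdnn : ∀ u v, 0 ≤ d u v)
    (hdsymm : ∀ u v, d u v = d v u)
    (hdtri : ∀ u v w, d u w ≤ d u v + d v w)
    (k m : ℕ) (hk : 10 ≤ k) (hm : 1 ≤ m)
    (ALG' : Finset α → Finset α)
    (hALG' : ∀ V : Finset α, k ≤ V.card →
      ALG' V ⊆ V ∧ (ALG' V).card = k ∧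
      ∀ R ⊆ V, R.card = k →
        (1 / 2) * (g R + sumsumDiv d R) ≤ g (ALG' V) + sumsumDiv d (ALG' V))
    (O : Finset α) (hOcard : O.card = k)
    (hOmax : ∀ R : Finset α, R.card = k →
      g R + sumsumDiv d R ≤ g O + sumsumDiv d O) :
    (1 / 31) * (g O + sumsumDiv d O)
      ≤ expVal m (fun π =>
          g (ALG' (Finset.univ.biUnion fun i => greedy g d k (part π i)))
            + sumsumDiv d (ALG' (Finset.univ.biUnion fun i => greedy g d k (part π i)))) := by
  obtain rfl : ‹DecidableEq α› = LinearOrder.toDecidableEq := Subsingleton.elim _ _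
  classical
  obtain ⟨h, l, rfl, hh, hl, hl'⟩ : ∃ h l, k = h + l ∧ 5 ≤ h ∧ h ≤ l ∧ l ≤ h + 1 :=
    ⟨k / 2, k - k / 2, by omega, by omega, by omega, by omega⟩
  have hmpow : (0 : ℝ) < (m : ℝ) ^ Fintype.card α := pow_pos (by exact_mod_cast hm) _
  rw [expVal, le_div_iff₀ hmpow]
  have hsum := pow_card_mul_le_sum_selected_add_rejected (d := d) hgsub hg0 (h + l) ⟨0, hm⟩ O
  have hpt : ∀ π : α → Fin m,
      g (O ∩ Finset.univ.biUnion fun i => greedy g d (h + l) (part π i)) +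
        g (O.filter fun o => o ∉ greedy g d (h + l) (insert o (part π ⟨0, hm⟩))) +
        sumsumDiv d O ≤
      31 * (g (ALG' (Finset.univ.biUnion fun i => greedy g d (h + l) (part π i))) +
        sumsumDiv d (ALG' (Finset.univ.biUnion fun i => greedy g d (h + l) (part π i)))) := by
    intro π
    have hmem : ∀ o, o ∈ (Finset.univ.biUnion fun i => greedy g d (h + l) (part π i)) ↔
      o ∈ greedy g d (h + l) (part π (π o)) := fun o => mem_biUnion_greedy_part
    have hsub : ∀ i, greedy g d (h + l) (part π i) ⊆
      Finset.univ.biUnion fun i => greedy g d (h + l) (part π i) := fun i =>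
        Finset.subset_biUnion_of_mem (fun i => greedy g d (h + l) (part π i)) (Finset.mem_univ i)
    set V := Finset.univ.biUnion fun i => greedy g d (h + l) (part π i)
    have hrej : ∀ u ∈ O \ V, u ∈ part π (π u) ∧ u ∉ greedy g d (h + l) (part π (π u)) :=
      fun u hu => ⟨mem_part.2 rfl, fun hm => (Finset.mem_sdiff.1 hu).2 ((hmem u).2 hm)⟩
    have hV : h + l ≤ V.card := by
      by_cases hOV : O ⊆ V
      · exact hOcard ▸ Finset.card_le_card hOV
      · obtain ⟨o, hoO, hoV⟩ := Finset.not_subset.1 hOV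
        have ho := hrej o (Finset.mem_sdiff.2 ⟨hoO, hoV⟩)
        exact (card_greedy ho.1 ho.2).symm.le.trans (Finset.card_le_card (hsub _))
    obtain ⟨-, -, hbest⟩ := hALG' V hV
    set F := g (ALG' V) + sumsumDiv d (ALG' V)
    have hQ : ∀ R ⊆ V, R.card ≤ h + l → g R + sumsumDiv d R ≤ 2 * F := fun R hR hRc => by
      obtain ⟨R', hRR', hR'V, hR'c⟩ := Finset.exists_subsuperset_card_eq hR hRc hV
      linarith [hbest R' hR'V hR'c, hgmono _ _ hRR', sumsumDiv_mono hdnn hRR']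
    have hdiv := sumsumDiv_le_inter_add hd0 hdnn hdsymm hdtri hh hl hl' (Q := 2 * F) (V := V)
      (fun R hR hRc => by linarith [hQ R hR hRc, hgnn R]) hOcard
      (fun u => greedy g d h (part π (π u)))
      (fun u _ => (greedy_mono _ (Nat.le_add_right h l)).trans (hsub _))
      (fun u hu => card_greedy (hrej u hu).1 fun hm =>
        (hrej u hu).2 (greedy_mono _ (Nat.le_add_right h l) hm))
      (fun u _ v _ => by
        by_cases he : π u = π v
        · exact Or.inl (by rw [he])
        · refine Or.inr (Finset.disjoint_left.2 fun x hx hy => he ?_)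
          rw [← mem_part.1 (greedy_subset _ _ hx), mem_part.1 (greedy_subset _ _ hy)])
      (fun u hu => (mul_sum_dist_le_greedy hgnn hgmono hd0 hdnn hdsymm (hrej u hu).1
        (hrej u hu).2).trans (hQ _ (hsub _) (card_greedy_le _ _)))
    have hB := le_of_forall_notMem_greedy hgnn hgmono hg0 hgsub hd0 hdnn hdsymm
      (k := h + l) (by omega) (T := part π ⟨0, hm⟩)
      (B := O.filter fun o => o ∉ greedy g d (h + l) (insert o (part π ⟨0, hm⟩)))
      (fun o ho => (Finset.mem_filter.1 ho).2)
      ((Finset.card_le_card (Finset.filter_subset _ _)).trans hOcard.le)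
    have hA := hQ (O ∩ V) Finset.inter_subset_right
      ((Finset.card_le_card Finset.inter_subset_left).trans hOcard.le)
    have hS := hQ _ (hsub ⟨0, hm⟩) (card_greedy_le _ _)
    have hSD := sumsumDiv_nonneg hdnn (greedy g d (h + l) (part π ⟨0, hm⟩))
    linarith
  have htot := Finset.sum_le_sum fun π (_ : π ∈ (Finset.univ : Finset (α → Fin m))) => hpt π
  rw [Finset.sum_add_distrib, ← Finset.mul_sum, Finset.sum_const, Finset.card_univ,
    Fintype.card_fun, Fintype.card_fin, nsmul_eq_mul] at htot
  push_cast at htot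
  linarith
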